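/- Let χ > 0, assume (B) and (init), and let (u, v) be the maximal classical solution of the crime model on Ω̄ × [0, T_max). For all T > 0 there exists C(T) > 0 such that, with T̂_max := min{T, T_max}, ∫_Ω v(·,t) ≤ C(T) for all t ∈ (0, T̂_max), and sup_{T>0} C(T) < ∞ if either hypothesis (H1) or hypothesis (H2) holds. -/

import Mathlib

open Real MeasureTheory Filter Topology Set
open scoped ENNReal NNReal

noncomputable section

/-- Partial derivative of a space-time function in the first (space) variable. -/
def pdx (f : ℝ → ℝ → ℝ) : ℝ → ℝ → ℝ := fun x t => deriv (fun y => f y t) x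

/-- Partial derivative of a space-time function in the second (time) variable. -/
def pdt (f : ℝ → ℝ → ℝ) : ℝ → ℝ → ℝ := fun x t => deriv (fun s => f x s) t

/-- The time interval `[0, Tmax)` (with `Tmax ∈ (0,∞]`). -/
def It (Tmax : ℝ≥0∞) : Set ℝ := {t : ℝ | 0 ≤ t ∧ ENNReal.ofReal t < Tmax}

/-- The time interval `(0, Tmax)` (with `Tmax ∈ (0,∞]`). -/
def It' (Tmax : ℝ≥0∞) : Set ℝ := {t : ℝ | 0 < t ∧ ENNReal.ofReal t < Tmax}

/-- The waiting time `τ := min{1, Tmax/3}`, as a real number. -/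
def tauOf (Tmax : ℝ≥0∞) : ℝ := (min 1 (Tmax / 3)).toReal

/-- Hypothesis (B): `B` is nonnegative, bounded, and locally Hölder continuous on
`Ω̄ × [0,∞)` with some exponent `ϑ ∈ (0,1)`. -/
def HypB (a b : ℝ) (B : ℝ → ℝ → ℝ) : Prop :=
  (∀ x t : ℝ, 0 ≤ B x t) ∧ (∃ M : ℝ, ∀ x t : ℝ, B x t ≤ M) ∧
  ∃ ϑ : ℝ, ϑ ∈ Set.Ioo (0:ℝ) 1 ∧
    ∀ K : Set (ℝ × ℝ), IsCompact K → K ⊆ (Set.Icc a b) ×ˢ (Set.Ici (0:ℝ)) →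
      ∃ C : ℝ, ∀ p ∈ K, ∀ q ∈ K, |B p.1 p.2 - B q.1 q.2| ≤ C * dist p q ^ ϑ

/-- Hypothesis (init): `u0 ∈ C⁰(Ω̄)` nonnegative, `v0 ∈ W^{1,∞}(Ω)` (i.e. Lipschitz)
positive on `Ω̄`. -/
def HypInit (a b : ℝ) (u0 v0 : ℝ → ℝ) : Prop :=
  ContinuousOn u0 (Set.Icc a b) ∧ (∀ x ∈ Set.Icc a b, 0 ≤ u0 x) ∧
  (∃ L : ℝ≥0, LipschitzOnWith L v0 (Set.Icc a b)) ∧ (∀ x ∈ Set.Icc a b, 0 < v0 x)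

/-- Hypothesis (H1): `∫_0^∞ ∫_Ω B1 < ∞`. -/
def HypH1 (a b : ℝ) (B1 : ℝ → ℝ → ℝ) : Prop :=
  MeasureTheory.IntegrableOn (fun p : ℝ × ℝ => B1 p.1 p.2)
    ((Set.Ioo a b) ×ˢ (Set.Ioi (0:ℝ)))

/-- Hypothesis (H1'): `∫_t^{t+1} ∫_Ω B1 → 0` as `t → ∞`. -/
def HypH1' (a b : ℝ) (B1 : ℝ → ℝ → ℝ) : Prop :=
  Filter.Tendsto (fun t : ℝ => ∫ s in t..(t+1), ∫ x in Set.Ioo a b, B1 x s)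
    Filter.atTop (nhds 0)

/-- Hypothesis (H2): `inf_{t>0} ∫_Ω B2(·,t) > 0`. -/
def HypH2 (a b : ℝ) (B2 : ℝ → ℝ → ℝ) : Prop :=
  ∃ c : ℝ, 0 < c ∧ ∀ t : ℝ, 0 < t → c ≤ ∫ x in Set.Ioo a b, B2 x t

/-- Hypothesis (H3): `B2(·,t)` stabilizes to `B2inf ∈ L²(Ω)` in the averaged `L²` sense. -/
def HypH3 (a b : ℝ) (B2 : ℝ → ℝ → ℝ) (B2inf : ℝ → ℝ) : Prop :=
  MeasureTheory.MemLp B2inf 2 (MeasureTheory.volume.restrict (Set.Ioo a b)) ∧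
  Filter.Tendsto
    (fun t : ℝ => ∫ s in t..(t+1), ∫ x in Set.Ioo a b, (B2 x s - B2inf x)^2)
    Filter.atTop (nhds 0)

/-- A classical solution of the urban crime system
`u_t = u_xx − χ (u/v · v_x)_x − uv + B1`, `v_t = v_xx + uv − v + B2` on
`Ω̄ × [0, Tmax)`, `Ω = (a,b)`, with homogeneous Neumann boundary conditions and
initial data `(u0, v0)`; `u, v` are positive on `Ω̄ × (0, Tmax)`, belong to
`C⁰(Ω̄ × [0,Tmax)) ∩ C^{2,1}(Ω̄ × (0,Tmax))` and `v(·,t)` lies in `W^{1,r}(Ω)`,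
continuously in `t`, for every `r > 1`. -/
structure CrimeSol (a b χ : ℝ) (B1 B2 : ℝ → ℝ → ℝ) (u0 v0 : ℝ → ℝ)
    (u v : ℝ → ℝ → ℝ) (Tmax : ℝ≥0∞) : Prop where
  u_cont : ContinuousOn (fun p : ℝ × ℝ => u p.1 p.2) ((Set.Icc a b) ×ˢ It Tmax)
  v_cont : ContinuousOn (fun p : ℝ × ℝ => v p.1 p.2) ((Set.Icc a b) ×ˢ It Tmax)
  u_init : ∀ x ∈ Set.Icc a b, u x 0 = u0 x
  v_init : ∀ x ∈ Set.Icc a b, v x 0 = v0 x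
  u_pos : ∀ x ∈ Set.Icc a b, ∀ t ∈ It' Tmax, 0 < u x t
  v_pos : ∀ x ∈ Set.Icc a b, ∀ t ∈ It' Tmax, 0 < v x t
  u_reg : ∀ x ∈ Set.Icc a b, ∀ t ∈ It' Tmax,
    DifferentiableAt ℝ (fun y => u y t) x ∧
    DifferentiableAt ℝ (fun y => pdx u y t) x ∧
    DifferentiableAt ℝ (fun s => u x s) t
  v_reg : ∀ x ∈ Set.Icc a b, ∀ t ∈ It' Tmax,
    DifferentiableAt ℝ (fun y => v y t) x ∧
    DifferentiableAt ℝ (fun y => pdx v y t) x ∧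
    DifferentiableAt ℝ (fun s => v x s) t
  u_cont21 : ContinuousOn
    (fun p : ℝ × ℝ => (pdx u p.1 p.2, pdx (pdx u) p.1 p.2, pdt u p.1 p.2))
    ((Set.Icc a b) ×ˢ It' Tmax)
  v_cont21 : ContinuousOn
    (fun p : ℝ × ℝ => (pdx v p.1 p.2, pdx (pdx v) p.1 p.2, pdt v p.1 p.2))
    ((Set.Icc a b) ×ˢ It' Tmax)
  v_W1r : ∀ r : ℝ, 1 < r →
    (∀ t ∈ It Tmax,
      MeasureTheory.IntegrableOn (fun x => |pdx v x t| ^ r) (Set.Ioo a b)) ∧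
    ContinuousOn (fun t => ∫ x in Set.Ioo a b, |pdx v x t| ^ r) (It Tmax)
  u_eq : ∀ x ∈ Set.Ioo a b, ∀ t ∈ It' Tmax,
    pdt u x t = pdx (pdx u) x t
      - χ * pdx (fun y s => u y s / v y s * pdx v y s) x t
      - u x t * v x t + B1 x t
  v_eq : ∀ x ∈ Set.Ioo a b, ∀ t ∈ It' Tmax,
    pdt v x t = pdx (pdx v) x t + u x t * v x t - v x t + B2 x t
  u_bc : ∀ t ∈ It' Tmax, pdx u a t = 0 ∧ pdx u b t = 0
  v_bc : ∀ t ∈ It' Tmax, pdx v a t = 0 ∧ pdx v b t = 0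

/-- A classical solution of the stationary Neumann problem
`−w'' + w = B` in `Ω = (a,b)`, `w' = 0` on `∂Ω`. -/
def IsStationarySol (a b : ℝ) (B : ℝ → ℝ) (w : ℝ → ℝ) : Prop :=
  ContinuousOn w (Set.Icc a b) ∧
  (∀ x ∈ Set.Icc a b, DifferentiableAt ℝ w x ∧ DifferentiableAt ℝ (deriv w) x) ∧
  (∀ x ∈ Set.Ioo a b, -(deriv (deriv w) x) + w x = B x) ∧
  deriv w a = 0 ∧ deriv w b = 0

/-- The branches `q^±(p) = (1−p)/2 · (1 ∓/± √(1 − pχ²))`. -/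
def qminus (χ p : ℝ) : ℝ := (1 - p) / 2 * (1 - Real.sqrt (1 - p * χ^2))

def qplus (χ p : ℝ) : ℝ := (1 - p) / 2 * (1 + Real.sqrt (1 - p * χ^2))

/-- The auxiliary functions `φ₁, φ₂, φ₃` and the constant `p₀`. -/
def phi1 (p : ℝ) : ℝ := (p + 1) / (1 - p)

def phi2 (χ p : ℝ) : ℝ := (1 - p) / (2 * p) * (1 + Real.sqrt (1 - p * χ^2))

def phi3 (χ p : ℝ) : ℝ := (1 - p) / (2 * p) * (1 - Real.sqrt (1 - p * χ^2))

def p0 : ℝ := (2 * Real.sqrt 3 - 3) / 3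

theorem aux_int {a b : ℝ} {f : ℝ → ℝ} (hf : ContinuousOn f (Icc a b)) :
    IntegrableOn f (Ioo a b) :=
  hf.integrableOn_Icc.mono_set Ioo_subset_Icc_self

theorem aux_slice {a b t : ℝ} {S : Set ℝ} {f : ℝ → ℝ → ℝ}
    (hf : ContinuousOn (fun p : ℝ × ℝ => f p.1 p.2) (Icc a b ×ˢ S)) (ht : t ∈ S) :
    ContinuousOn (fun x => f x t) (Icc a b) :=
  hf.comp (f := fun x : ℝ => (x, t)) (by fun_prop) (fun x hx => ⟨hx, ht⟩)

theorem aux_deriv {a b t : ℝ} {S : Set ℝ} (hS : IsOpen S) (ht : t ∈ S) {f f' : ℝ → ℝ → ℝ}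
    (hf : ContinuousOn (fun p : ℝ × ℝ => f p.1 p.2) (Icc a b ×ˢ S))
    (hf' : ContinuousOn (fun p : ℝ × ℝ => f' p.1 p.2) (Icc a b ×ˢ S))
    (hd : ∀ x ∈ Icc a b, ∀ s ∈ S, HasDerivAt (fun r => f x r) (f' x s) s) :
    HasDerivAt (fun s => ∫ x in Ioo a b, f x s) (∫ x in Ioo a b, f' x t) t := by
  obtain ⟨ε, hε, hball⟩ := Metric.nhds_basis_closedBall.mem_iff.1 (hS.mem_nhds ht)
  have hK : IsCompact (Icc a b ×ˢ Metric.closedBall t ε) :=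
    isCompact_Icc.prod (isCompact_closedBall t ε)
  obtain ⟨C, hC⟩ := hK.exists_bound_of_continuousOn
    (hf'.mono (Set.prod_mono Subset.rfl hball))
  have hI := hasDerivAt_integral_of_dominated_loc_of_deriv_le (μ := volume.restrict (Ioo a b))
    (F := fun s x => f x s) (F' := fun s x => f' x s) (x₀ := t) (bound := fun _ => C)
    (Metric.closedBall_mem_nhds t hε) ?_ (aux_int (aux_slice hf ht))
    (aux_int (aux_slice hf' ht)).aestronglyMeasurable ?_ ?_ ?_
  · exact hI.2
  · filter_upwards [hS.mem_nhds ht] with s hs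
    exact (aux_int (aux_slice hf hs)).aestronglyMeasurable
  · refine (ae_restrict_iff' measurableSet_Ioo).2 (ae_of_all _ fun x hx s hs => ?_)
    exact hC (x, s) ⟨Ioo_subset_Icc_self hx, hs⟩
  · exact (integrableOn_const (by simp))
  · refine (ae_restrict_iff' measurableSet_Ioo).2 (ae_of_all _ fun x hx s hs => ?_)
    exact hd x (Ioo_subset_Icc_self hx) s (hball hs)

theorem aux_ftc {a b : ℝ} (hab : a < b) {g g' : ℝ → ℝ}
    (hg : ∀ x ∈ Icc a b, HasDerivAt g (g' x) x) (hg' : ContinuousOn g' (Icc a b)) :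
    ∫ x in Ioo a b, g' x = g b - g a := by
  rw [← integral_Ioc_eq_integral_Ioo, ← intervalIntegral.integral_of_le hab.le]
  refine intervalIntegral.integral_eq_sub_of_hasDerivAt (fun x hx => hg x ?_) ?_
  · rwa [uIcc_of_le hab.le] at hx
  · exact ContinuousOn.intervalIntegrable (by rwa [uIcc_of_le hab.le])

theorem aux_gronwall {C t1 t : ℝ} (h : t1 ≤ t) {E E' : ℝ → ℝ}
    (hd : ∀ s ∈ Icc t1 t, HasDerivAt E (E' s) s) (hle : ∀ s ∈ Icc t1 t, E' s ≤ C - E s) :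
    E t ≤ C + |E t1| + |C| := by
  have hG : ∀ s ∈ Icc t1 t, HasDerivAt (fun s => exp (s - t1) * (E s - C))
      (exp (s - t1) * 1 * (E s - C) + exp (s - t1) * (E' s)) s := fun s hs =>
    (((hasDerivAt_id s).sub_const t1).exp).mul ((hd s hs).sub_const C)
  have hanti : AntitoneOn (fun s => exp (s - t1) * (E s - C)) (Icc t1 t) := by
    apply antitoneOn_of_deriv_nonpos (convex_Icc _ _)
    · exact fun s hs => (hG s hs).continuousAt.continuousWithinAt
    · exact fun s hs => (hG s (interior_subset hs)).differentiableAt.differentiableWithinAt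
    · intro s hs
      rw [(hG s (interior_subset hs)).deriv]
      have := hle s (interior_subset hs)
      have h2 := exp_pos (s - t1)
      nlinarith
  have h1 := hanti (left_mem_Icc.2 h) (right_mem_Icc.2 h) h
  simp only [sub_self, exp_zero, one_mul] at h1
  have h2 : 1 ≤ exp (t - t1) := one_le_exp (by linarith)
  have h3 := le_abs_self (E t1)
  have h4 := neg_le_abs C
  by_contra hcon
  push Not at hcon
  have h5 : 0 ≤ E t - C := by
    have := abs_nonneg (E t1); have := abs_nonneg C; linarith
  nlinarith

theorem aux_static {a b c : ℝ} (hab : a < b) (hc : 0 < c) {w w' B : ℝ → ℝ}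
    (hw : ∀ x ∈ Icc a b, HasDerivAt w (w' x) x) (hw' : ContinuousOn w' (Icc a b))
    (hpos : ∀ x ∈ Icc a b, 0 < w x) (hB : ∀ x, 0 ≤ B x) (hBi : IntegrableOn B (Ioo a b))
    (hBw : IntegrableOn (fun x => B x / w x) (Ioo a b)) (hcB : c ≤ ∫ x in Ioo a b, B x) :
    -(∫ x in Ioo a b, log (w x)) ≤ (∫ x in Ioo a b, (w' x / w x)^2) + (∫ x in Ioo a b, B x / w x)
      + ((b - a)^3 / 4 + (b - a) * (- log (c / (b - a)) - 1)) := by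
  have hl : 0 < b - a := sub_pos.2 hab
  have hwc : ContinuousOn w (Icc a b) := fun x hx => (hw x hx).continuousAt.continuousWithinAt
  have hq : ContinuousOn (fun x => w' x / w x) (Icc a b) :=
    hw'.div hwc (fun x hx => (hpos x hx).ne')
  have hlog : ContinuousOn (fun x => log (w x)) (Icc a b) :=
    hwc.log (fun x hx => (hpos x hx).ne')
  have hvol : volume.real (Ioo a b) = b - a := by simp [hl.le]
  obtain ⟨x0, hx0, hmax⟩ := isCompact_Icc.exists_isMaxOn (nonempty_Icc.2 hab.le) hwc
  set D := ∫ x in Ioo a b, (w' x / w x)^2 with hD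
  have hw0 := hpos x0 hx0
  -- B / w
  have h1 : c / w x0 ≤ ∫ x in Ioo a b, B x / w x := by
    calc c / w x0 ≤ (∫ x in Ioo a b, B x) / w x0 := by gcongr
      _ = ∫ x in Ioo a b, B x / w x0 := by rw [integral_div]
      _ ≤ _ := by
        refine setIntegral_mono_on (hBi.div_const _) hBw measurableSet_Ioo fun x hx => ?_
        have hx' := Ioo_subset_Icc_self hx
        exact div_le_div_of_nonneg_left (hB x) (hpos x hx') (hmax hx')
  have h2 : - log (w x0) ≤ c / (b - a) * (1 / w x0) - log (c / (b - a)) - 1 := by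
    have h3 : 0 < c / (b - a) * (1 / w x0) := by positivity
    have h4 := log_le_sub_one_of_pos h3
    rw [log_mul (by positivity) (by positivity), one_div, log_inv] at h4
    rw [one_div]
    linarith
  have h3 : ∀ x ∈ Icc a b, |log (w x0) - log (w x)| ≤ ∫ y in Ioo a b, |w' y / w y| := by
    intro x hx
    have hsub : uIcc x x0 ⊆ Icc a b := uIcc_subset_Icc hx hx0
    rw [← intervalIntegral.integral_eq_sub_of_hasDerivAt (f := fun x => log (w x))
      (f' := fun x => w' x / w x) (fun y hy => (hw y (hsub hy)).log (hpos y (hsub hy)).ne')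
      (hq.mono hsub).intervalIntegrable]
    have hn : ‖∫ y in x..x0, w' y / w y‖ ≤ ∫ y in uIoc x x0, ‖w' y / w y‖ :=
      intervalIntegral.norm_integral_le_integral_norm_uIoc
    refine hn.trans ?_
    rw [← integral_Icc_eq_integral_Ioo]
    refine setIntegral_mono_set hq.abs.integrableOn_Icc (ae_of_all _ fun y => abs_nonneg _)
      (LE.le.eventuallyLE (uIoc_subset_uIcc.trans hsub))
  have h4 : ∫ y in Ioo a b, |w' y / w y| ≤ D / (b - a) + (b - a)^2 / 4 := by
    have : ∫ y in Ioo a b, |w' y / w y| ≤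
        ∫ y in Ioo a b, ((w' y / w y)^2 / (b - a) + (b - a) / 4) := by
      refine setIntegral_mono_on (aux_int hq.abs) (aux_int ?_) measurableSet_Ioo fun x hx => ?_
      · exact ((hq.pow 2).div_const _).add continuousOn_const
      · rw [← sq_abs (w' x / w x)]
        set z := |w' x / w x|
        have : z ^ 2 / (b - a) + (b - a) / 4 - z = (z - (b - a) / 2)^2 / (b - a) := by
          field_simp; ring
        have h6 : 0 ≤ (z - (b - a) / 2)^2 / (b - a) := by positivity
        linarith
    refine this.trans (le_of_eq ?_)
    have hq2 : ContinuousOn (fun x => (w' x / w x) ^ 2 / (b - a)) (Icc a b) :=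
      (hq.pow 2).div_const _
    rw [integral_add (aux_int hq2) (aux_int continuousOn_const),
      integral_div, setIntegral_const, hvol, smul_eq_mul]
    ring
  have h5 : -(∫ x in Ioo a b, log (w x)) ≤
      ∫ x in Ioo a b, (- log (w x0) + (D / (b - a) + (b - a)^2 / 4)) := by
    rw [← integral_neg]
    refine setIntegral_mono_on (aux_int hlog.neg) (aux_int continuousOn_const)
      measurableSet_Ioo fun x hx => ?_
    have := (le_abs_self _).trans ((h3 x (Ioo_subset_Icc_self hx)).trans h4)
    linarith
  rw [setIntegral_const, hvol, smul_eq_mul] at h5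
  have h6 : (b - a) * (- log (w x0)) ≤ (b - a) *
      (c / (b - a) * (1 / w x0) - log (c / (b - a)) - 1) := by gcongr
  have h7 : (b - a) * (c / (b - a) * (1 / w x0)) = c / w x0 := by field_simp
  have h8 : (b - a) * (D / (b - a)) = D := by field_simp
  nlinarith

theorem aux_open (Tmax : ℝ≥0∞) : IsOpen (It' Tmax) :=
  (isOpen_lt continuous_const continuous_id).inter
    (isOpen_lt ENNReal.continuous_ofReal continuous_const)

section sol
variable {a b χ : ℝ} {B1 B2 : ℝ → ℝ → ℝ} {u0 v0 : ℝ → ℝ} {u v : ℝ → ℝ → ℝ} {Tmax : ℝ≥0∞}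

theorem aux_It'_sub : It' Tmax ⊆ It Tmax := fun _ ht => ⟨ht.1.le, ht.2⟩

theorem aux_prod_sub : Icc a b ×ˢ It' Tmax ⊆ Icc a b ×ˢ It Tmax :=
  Set.prod_mono Subset.rfl aux_It'_sub

theorem sol_ux (h : CrimeSol a b χ B1 B2 u0 v0 u v Tmax) :
    ContinuousOn (fun p : ℝ × ℝ => pdx u p.1 p.2) (Icc a b ×ˢ It' Tmax) := h.u_cont21.fst
theorem sol_uxx (h : CrimeSol a b χ B1 B2 u0 v0 u v Tmax) :
    ContinuousOn (fun p : ℝ × ℝ => pdx (pdx u) p.1 p.2) (Icc a b ×ˢ It' Tmax) :=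
  h.u_cont21.snd.fst
theorem sol_ut (h : CrimeSol a b χ B1 B2 u0 v0 u v Tmax) :
    ContinuousOn (fun p : ℝ × ℝ => pdt u p.1 p.2) (Icc a b ×ˢ It' Tmax) :=
  h.u_cont21.snd.snd
theorem sol_vx (h : CrimeSol a b χ B1 B2 u0 v0 u v Tmax) :
    ContinuousOn (fun p : ℝ × ℝ => pdx v p.1 p.2) (Icc a b ×ˢ It' Tmax) := h.v_cont21.fst
theorem sol_vxx (h : CrimeSol a b χ B1 B2 u0 v0 u v Tmax) :
    ContinuousOn (fun p : ℝ × ℝ => pdx (pdx v) p.1 p.2) (Icc a b ×ˢ It' Tmax) :=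
  h.v_cont21.snd.fst
theorem sol_vt (h : CrimeSol a b χ B1 B2 u0 v0 u v Tmax) :
    ContinuousOn (fun p : ℝ × ℝ => pdt v p.1 p.2) (Icc a b ×ˢ It' Tmax) :=
  h.v_cont21.snd.snd

theorem sol_B2 (h : CrimeSol a b χ B1 B2 u0 v0 u v Tmax) {t : ℝ} (ht : t ∈ It' Tmax) :
    ∃ g : ℝ → ℝ, ContinuousOn g (Icc a b) ∧ ∀ x ∈ Ioo a b, B2 x t = g x := by
  refine ⟨fun x => pdt v x t - pdx (pdx v) x t - u x t * v x t + v x t, ?_, ?_⟩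
  · have h1 := aux_slice (sol_vt h) ht
    have h2 := aux_slice (sol_vxx h) ht
    have h3 := aux_slice h.u_cont (aux_It'_sub ht)
    have h4 := aux_slice h.v_cont (aux_It'_sub ht)
    exact ((h1.sub h2).sub (h3.mul h4)).add h4
  · intro x hx
    have := h.v_eq x hx t ht
    linarith

theorem sol_flux (h : CrimeSol a b χ B1 B2 u0 v0 u v Tmax) {t : ℝ} (ht : t ∈ It' Tmax) :
    ContinuousOn (fun x => pdx (fun y s => u y s / v y s * pdx v y s) x t) (Icc a b) ∧
    ∀ x ∈ Icc a b, HasDerivAt (fun y => u y t / v y t * pdx v y t)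
      (pdx (fun y s => u y s / v y s * pdx v y s) x t) x := by
  have hd : ∀ x ∈ Icc a b, HasDerivAt (fun y => u y t / v y t * pdx v y t)
      ((pdx u x t * v x t - u x t * pdx v x t) / v x t ^ 2 * pdx v x t
        + u x t / v x t * pdx (pdx v) x t) x := by
    intro x hx
    have h1 := (h.u_reg x hx t ht).1.hasDerivAt
    have h2 := (h.v_reg x hx t ht).1.hasDerivAt
    have h3 := (h.v_reg x hx t ht).2.1.hasDerivAt
    exact (h1.div h2 (h.v_pos x hx t ht).ne').mul h3
  refine ⟨?_, fun x hx => (hd x hx).differentiableAt.hasDerivAt⟩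
  have c1 := aux_slice (sol_vx h) ht
  have c2 := aux_slice (sol_vxx h) ht
  have c3 := aux_slice h.u_cont (aux_It'_sub ht)
  have c4 := aux_slice h.v_cont (aux_It'_sub ht)
  have c5 := aux_slice (sol_ux h) ht
  have hne : ∀ x ∈ Icc a b, v x t ≠ 0 := fun x hx => (h.v_pos x hx t ht).ne'
  refine ContinuousOn.congr (f := fun x =>
    (pdx u x t * v x t - u x t * pdx v x t) / v x t ^ 2 * pdx v x t
        + u x t / v x t * pdx (pdx v) x t) ?_ (fun x hx => (hd x hx).deriv)
  exact ((((c5.mul c4).sub (c3.mul c1)).div (c4.pow 2)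
    (fun x hx => pow_ne_zero 2 (hne x hx))).mul c1).add ((c3.div c4 hne).mul c2)

theorem sol_U (hab : a < b) (h : CrimeSol a b χ B1 B2 u0 v0 u v Tmax) {t : ℝ}
    (ht : t ∈ It' Tmax) :
    HasDerivAt (fun s => ∫ x in Ioo a b, u x s)
      ((∫ x in Ioo a b, B1 x t) - ∫ x in Ioo a b, u x t * v x t) t ∧
    IntegrableOn (fun x => B1 x t) (Ioo a b) := by
  have hder := aux_deriv (aux_open Tmax) ht (f := u) (f' := pdt u)
    (h.u_cont.mono aux_prod_sub) (sol_ut h)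
    (fun x hx s hs => (h.u_reg x hx s hs).2.2.hasDerivAt)
  have c1 := aux_slice (sol_ut h) ht
  have c2 := aux_slice (sol_uxx h) ht
  have c3 := aux_slice h.u_cont (aux_It'_sub ht)
  have c4 := aux_slice h.v_cont (aux_It'_sub ht)
  obtain ⟨c5, d5⟩ := sol_flux h ht
  set Φ := fun x => pdx (fun y s => u y s / v y s * pdx v y s) x t with hΦ
  have huv : ContinuousOn (fun x => u x t * v x t) (Icc a b) := c3.mul c4
  have hchi : ContinuousOn (fun x => χ * Φ x) (Icc a b) := c5.const_smul χ
  have hg : ContinuousOn (fun x => pdt u x t - pdx (pdx u) x t + χ * Φ x + u x t * v x t)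
      (Icc a b) := ((c1.sub c2).add hchi).add huv
  have hB : ∀ x ∈ Ioo a b, B1 x t = pdt u x t - pdx (pdx u) x t + χ * Φ x + u x t * v x t := by
    intro x hx
    have := h.u_eq x hx t ht
    simp only [hΦ]
    linarith
  have hint : IntegrableOn (fun x => B1 x t) (Ioo a b) :=
    (aux_int hg).congr_fun (fun x hx => (hB x hx).symm) measurableSet_Ioo
  refine ⟨?_, hint⟩
  have e1 : ∫ x in Ioo a b, pdx (pdx u) x t = 0 := by
    rw [aux_ftc hab (g := fun x => pdx u x t) (g' := fun x => pdx (pdx u) x t)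
      (fun x hx => (h.u_reg x hx t ht).2.1.hasDerivAt) c2]
    simp [h.u_bc t ht]
  have e2 : ∫ x in Ioo a b, Φ x = 0 := by
    rw [aux_ftc hab d5 c5]
    simp [h.v_bc t ht]
  convert hder using 1
  have e3 : ∫ x in Ioo a b, pdt u x t = ∫ x in Ioo a b,
      (pdx (pdx u) x t - χ * Φ x - u x t * v x t + B1 x t) :=
    setIntegral_congr_fun measurableSet_Ioo (fun x hx => h.u_eq x hx t ht)
  have i12 : IntegrableOn (fun x => pdx (pdx u) x t - χ * Φ x) (Ioo a b) := aux_int (c2.sub hchi)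
  have i123 : IntegrableOn (fun x => pdx (pdx u) x t - χ * Φ x - u x t * v x t) (Ioo a b) :=
    aux_int ((c2.sub hchi).sub huv)
  rw [e3, integral_add i123 hint, integral_sub i12 (aux_int huv),
    integral_sub (aux_int c2) (aux_int hchi), integral_const_mul, e1, e2]
  ring

theorem sol_V (hab : a < b) (h : CrimeSol a b χ B1 B2 u0 v0 u v Tmax) {t : ℝ}
    (ht : t ∈ It' Tmax) :
    HasDerivAt (fun s => ∫ x in Ioo a b, v x s)
      ((∫ x in Ioo a b, u x t * v x t) - (∫ x in Ioo a b, v x t) + ∫ x in Ioo a b, B2 x t) t ∧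
    IntegrableOn (fun x => B2 x t) (Ioo a b) := by
  have hder := aux_deriv (aux_open Tmax) ht (f := v) (f' := pdt v)
    (h.v_cont.mono aux_prod_sub) (sol_vt h)
    (fun x hx s hs => (h.v_reg x hx s hs).2.2.hasDerivAt)
  have c2 := aux_slice (sol_vxx h) ht
  have c3 := aux_slice h.u_cont (aux_It'_sub ht)
  have c4 := aux_slice h.v_cont (aux_It'_sub ht)
  have huv : ContinuousOn (fun x => u x t * v x t) (Icc a b) := c3.mul c4
  obtain ⟨g, hg, hB⟩ := sol_B2 h ht
  have hint : IntegrableOn (fun x => B2 x t) (Ioo a b) :=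
    (aux_int hg).congr_fun (fun x hx => (hB x hx).symm) measurableSet_Ioo
  refine ⟨?_, hint⟩
  have e1 : ∫ x in Ioo a b, pdx (pdx v) x t = 0 := by
    rw [aux_ftc hab (g := fun x => pdx v x t) (g' := fun x => pdx (pdx v) x t)
      (fun x hx => (h.v_reg x hx t ht).2.1.hasDerivAt) c2]
    simp [h.v_bc t ht]
  convert hder using 1
  have e3 : ∫ x in Ioo a b, pdt v x t = ∫ x in Ioo a b,
      (pdx (pdx v) x t + u x t * v x t - v x t + B2 x t) :=
    setIntegral_congr_fun measurableSet_Ioo (fun x hx => h.v_eq x hx t ht)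
  have i12 : IntegrableOn (fun x => pdx (pdx v) x t + u x t * v x t) (Ioo a b) :=
    aux_int (c2.add huv)
  have i123 : IntegrableOn (fun x => pdx (pdx v) x t + u x t * v x t - v x t) (Ioo a b) :=
    aux_int ((c2.add huv).sub c4)
  rw [e3, integral_add i123 hint, integral_sub i12 (aux_int c4),
    integral_add (aux_int c2) (aux_int huv), e1]
  ring

theorem sol_L (hab : a < b) (h : CrimeSol a b χ B1 B2 u0 v0 u v Tmax) {t : ℝ}
    (ht : t ∈ It' Tmax) :
    HasDerivAt (fun s => ∫ x in Ioo a b, log (v x s))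
      ((∫ x in Ioo a b, (pdx v x t / v x t)^2) + (∫ x in Ioo a b, u x t) - (b - a)
        + ∫ x in Ioo a b, B2 x t / v x t) t ∧
    IntegrableOn (fun x => B2 x t / v x t) (Ioo a b) := by
  have hvc := h.v_cont.mono (aux_prod_sub (a := a) (b := b) (Tmax := Tmax))
  have hne2 : ∀ p ∈ Icc a b ×ˢ It' Tmax, v p.1 p.2 ≠ 0 :=
    fun p hp => (h.v_pos p.1 hp.1 p.2 hp.2).ne'
  have hder := aux_deriv (aux_open Tmax) ht (f := fun x s => log (v x s))
    (f' := fun x s => pdt v x s / v x s)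
    (hvc.log hne2) ((sol_vt h).div hvc hne2)
    (fun x hx s hs => (h.v_reg x hx s hs).2.2.hasDerivAt.log (h.v_pos x hx s hs).ne')
  have hne : ∀ x ∈ Icc a b, v x t ≠ 0 := fun x hx => (h.v_pos x hx t ht).ne'
  have c1 := aux_slice (sol_vx h) ht
  have c2 := aux_slice (sol_vxx h) ht
  have c3 := aux_slice h.u_cont (aux_It'_sub ht)
  have c4 := aux_slice h.v_cont (aux_It'_sub ht)
  obtain ⟨g, hg, hB⟩ := sol_B2 h ht
  have hint : IntegrableOn (fun x => B2 x t / v x t) (Ioo a b) :=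
    (aux_int (hg.div c4 hne)).congr_fun (fun x hx => by simp [hB x hx])
      measurableSet_Ioo
  refine ⟨?_, hint⟩
  have cD : ContinuousOn (fun x => (pdx v x t / v x t)^2) (Icc a b) := (c1.div c4 hne).pow 2
  have cG : ContinuousOn (fun x => (pdx (pdx v) x t * v x t - pdx v x t * pdx v x t) / v x t ^ 2)
      (Icc a b) :=
    ((c2.mul c4).sub (c1.mul c1)).div (c4.pow 2) (fun x hx => pow_ne_zero 2 (hne x hx))
  have e1 : ∫ x in Ioo a b,
      (pdx (pdx v) x t * v x t - pdx v x t * pdx v x t) / v x t ^ 2 = 0 := by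
    rw [aux_ftc hab (g := fun x => pdx v x t / v x t)
      (g' := fun x => (pdx (pdx v) x t * v x t - pdx v x t * pdx v x t) / v x t ^ 2)
      (fun x hx => (h.v_reg x hx t ht).2.1.hasDerivAt.div
        (h.v_reg x hx t ht).1.hasDerivAt (hne x hx)) cG]
    simp [h.v_bc t ht]
  convert hder using 1
  have e3 : ∫ x in Ioo a b, pdt v x t / v x t = ∫ x in Ioo a b,
      ((pdx (pdx v) x t * v x t - pdx v x t * pdx v x t) / v x t ^ 2
        + (pdx v x t / v x t)^2 + u x t - 1 + B2 x t / v x t) := by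
    refine setIntegral_congr_fun measurableSet_Ioo (fun x hx => ?_)
    have h1 := hne x (Ioo_subset_Icc_self hx)
    simp only [h.v_eq x hx t ht]
    field_simp
    ring
  have i1 : IntegrableOn (fun x => (pdx (pdx v) x t * v x t - pdx v x t * pdx v x t) / v x t ^ 2
        + (pdx v x t / v x t)^2) (Ioo a b) := aux_int (cG.add cD)
  have i2 : IntegrableOn (fun x => (pdx (pdx v) x t * v x t - pdx v x t * pdx v x t) / v x t ^ 2
        + (pdx v x t / v x t)^2 + u x t) (Ioo a b) := aux_int ((cG.add cD).add c3)
  have i3 : IntegrableOn (fun x => (pdx (pdx v) x t * v x t - pdx v x t * pdx v x t) / v x t ^ 2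
        + (pdx v x t / v x t)^2 + u x t - 1) (Ioo a b) :=
    aux_int (((cG.add cD).add c3).sub continuousOn_const)
  rw [e3, integral_add i3 hint, integral_sub i2 (aux_int continuousOn_const),
    integral_add i1 (aux_int c3), integral_add (aux_int cG) (aux_int cD), e1,
    setIntegral_const]
  simp [hab.le]

theorem sol_start (h : CrimeSol a b χ B1 B2 u0 v0 u v Tmax) (hT : 0 < Tmax) :
    ∃ t1 ∈ It' Tmax, ∃ K : ℝ, 0 < K ∧ ∀ t ∈ Icc 0 t1, (∫ x in Ioo a b, v x t) ≤ K := by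
  obtain ⟨r, hr0, hr⟩ := ENNReal.lt_iff_exists_nnreal_btwn.1 hT
  have hrT : (r : ℝ) ∈ It' Tmax := ⟨by exact_mod_cast hr0, by simpa using hr⟩
  refine ⟨r, hrT, ?_⟩
  have hsub : Icc (0:ℝ) r ⊆ It Tmax := fun s hs =>
    ⟨hs.1, (ENNReal.ofReal_le_ofReal hs.2).trans_lt hrT.2⟩
  obtain ⟨C, hC⟩ := (isCompact_Icc.prod isCompact_Icc).exists_bound_of_continuousOn
    (h.v_cont.mono (Set.prod_mono (Subset.refl (Icc a b)) hsub))
  refine ⟨|C * volume.real (Ioo a b)| + 1, by positivity, fun t ht => ?_⟩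
  have := norm_setIntegral_le_of_norm_le_const (μ := volume) (s := Ioo a b) (f := fun x => v x t)
    (C := C) (by simp) (fun x hx => hC (x, t) ⟨Ioo_subset_Icc_self hx, ht⟩)
  have h1 := le_abs_self (∫ x in Ioo a b, v x t)
  have h2 := le_abs_self (C * volume.real (Ioo a b))
  rw [Real.norm_eq_abs] at this
  linarith

end sol

/-- Lemma 2.5 (bound on `∫_Ω v`, uniform in time under (H1) or (H2)). -/
theorem mass_bound_for_v
    (a b χ : ℝ) (hab : a < b) (hχ : 0 < χ)
    (B1 B2 : ℝ → ℝ → ℝ) (hB1 : HypB a b B1) (hB2 : HypB a b B2)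
    (u0 v0 : ℝ → ℝ) (hinit : HypInit a b u0 v0)
    (Tmax : ℝ≥0∞) (hT : 0 < Tmax)
    (u v : ℝ → ℝ → ℝ) (hsol : CrimeSol a b χ B1 B2 u0 v0 u v Tmax) :
    (∀ T : ℝ, 0 < T → ∃ C : ℝ, 0 < C ∧
      ∀ t : ℝ, 0 < t → ENNReal.ofReal t < min (ENNReal.ofReal T) Tmax →
        (∫ x in Set.Ioo a b, v x t) ≤ C) ∧
    ((HypH1 a b B1 ∨ HypH2 a b B2) → ∃ C : ℝ, 0 < C ∧
      ∀ t ∈ It' Tmax, (∫ x in Set.Ioo a b, v x t) ≤ C) := by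
  obtain ⟨hB1n, ⟨M1, hM1⟩, -⟩ := hB1
  obtain ⟨hB2n, ⟨M2, hM2⟩, -⟩ := hB2
  obtain ⟨t1, ht1, K, hK, hstart⟩ := sol_start hsol hT
  have hl : 0 < b - a := sub_pos.2 hab
  have hvol : volume.real (Ioo a b) = b - a := by simp [hl.le]
  have hIcc : ∀ t ∈ It' Tmax, Icc t1 t ⊆ It' Tmax := fun t ht s hs =>
    ⟨ht1.1.trans_le hs.1, (ENNReal.ofReal_le_ofReal hs.2).trans_lt ht.2⟩
  have hb1 : ∀ t ∈ It' Tmax, (∫ x in Ioo a b, B1 x t) ≤ (b - a) * M1 := by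
    intro t ht
    have := setIntegral_mono_on (sol_U hab hsol ht).2
      (aux_int (continuousOn_const (c := M1))) measurableSet_Ioo (fun x _ => hM1 x t)
    rwa [setIntegral_const, hvol, smul_eq_mul] at this
  have hb2 : ∀ t ∈ It' Tmax, (∫ x in Ioo a b, B2 x t) ≤ (b - a) * M2 := by
    intro t ht
    have := setIntegral_mono_on (sol_V hab hsol ht).2
      (aux_int (continuousOn_const (c := M2))) measurableSet_Ioo (fun x _ => hM2 x t)
    rwa [setIntegral_const, hvol, smul_eq_mul] at this
  have hM1' : 0 ≤ M1 := (hB1n 0 0).trans (hM1 0 0)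
  have hM2' : 0 ≤ M2 := (hB2n 0 0).trans (hM2 0 0)
  have hU0 : ∀ t ∈ It' Tmax, 0 ≤ ∫ x in Ioo a b, u x t := fun t ht =>
    setIntegral_nonneg measurableSet_Ioo
      (fun x hx => (hsol.u_pos x (Ioo_subset_Icc_self hx) t ht).le)
  have hV0 : ∀ t ∈ It' Tmax, 0 ≤ ∫ x in Ioo a b, v x t := fun t ht =>
    setIntegral_nonneg measurableSet_Ioo
      (fun x hx => (hsol.v_pos x (Ioo_subset_Icc_self hx) t ht).le)
  have hUV0 : ∀ t ∈ It' Tmax, 0 ≤ ∫ x in Ioo a b, u x t * v x t := fun t ht =>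
    setIntegral_nonneg measurableSet_Ioo
      (fun x hx => (mul_pos (hsol.u_pos x (Ioo_subset_Icc_self hx) t ht)
        (hsol.v_pos x (Ioo_subset_Icc_self hx) t ht)).le)
  -- it suffices to bound the mass of v after time t1
  have key : ∀ (T : Set ℝ) (C : ℝ), T ⊆ It' Tmax →
      (∀ t ∈ T, t1 ≤ t → (∫ x in Ioo a b, v x t) ≤ C) →
      ∃ C : ℝ, 0 < C ∧ ∀ t ∈ T, (∫ x in Ioo a b, v x t) ≤ C := by
    intro T C hTs hC
    refine ⟨max K C, lt_max_of_lt_left hK, fun t ht => ?_⟩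
    rcases le_total t t1 with h | h
    · exact (hstart t ⟨(hTs ht).1.le, h⟩).trans (le_max_left _ _)
    · exact (hC t ht h).trans (le_max_right _ _)
  refine ⟨?_, ?_⟩
  · intro T hTpos
    set A := (b - a) * M1 + (b - a) * M2
    have hA : 0 ≤ A := by positivity
    set M := fun s => (∫ x in Ioo a b, u x s) + ∫ x in Ioo a b, v x s with hM
    have hC' : ∀ t ∈ {t | t ∈ It' Tmax ∧ t < T}, t1 ≤ t →
        (∫ x in Ioo a b, v x t) ≤ M t1 + A * T := by
      rintro t ⟨ht, htT⟩ htt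
      have hd : ∀ s ∈ Icc t1 t, HasDerivAt M _ s := fun s hs =>
        (sol_U hab hsol (hIcc t ht hs)).1.add (sol_V hab hsol (hIcc t ht hs)).1
      have h1 : M t - M t1 ≤ A * (t - t1) := by
        apply (convex_Icc t1 t).image_sub_le_mul_sub_of_deriv_le
          (fun s hs => (hd s hs).continuousAt.continuousWithinAt)
          (fun s hs => (hd s (interior_subset hs)).differentiableAt.differentiableWithinAt)
          ?_ t1 (left_mem_Icc.2 htt) t (right_mem_Icc.2 htt) htt
        intro s hs
        have hs' := hIcc t ht (interior_subset hs)
        rw [(hd s (interior_subset hs)).deriv]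
        have := hb1 s hs'; have := hb2 s hs'; have := hV0 s hs'
        simp only [A]
        linarith
      have h2 : A * (t - t1) ≤ A * T := by
        apply mul_le_mul_of_nonneg_left _ hA
        have := ht1.1
        linarith
      have h3 := hU0 t ht
      simp only [hM] at h1 ⊢
      linarith
    obtain ⟨C, hC0, hC⟩ := key {t | t ∈ It' Tmax ∧ t < T} (M t1 + A * T) (fun t ht => ht.1) hC'
    refine ⟨C, hC0, fun t ht htT => hC t ⟨⟨ht, htT.trans_le (min_le_right _ _)⟩, ?_⟩⟩
    exact (ENNReal.ofReal_lt_ofReal_iff hTpos).1 (htT.trans_le (min_le_left _ _))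
  · rintro (hH | ⟨c, hc, hH⟩)
    · -- (H1)
      have hH' : Integrable (fun p : ℝ × ℝ => B1 p.1 p.2)
          ((volume.restrict (Ioo a b)).prod (volume.restrict (Ioi (0:ℝ)))) := by
        rw [Measure.prod_restrict]
        exact hH
      have hβ : IntegrableOn (fun s => ∫ x in Ioo a b, B1 x s) (Ioi (0:ℝ)) :=
        hH'.integral_prod_right
      have hβ0 : ∀ s, 0 ≤ ∫ x in Ioo a b, B1 x s := fun s =>
        integral_nonneg (fun x => hB1n x s)
      set U1 := (∫ x in Ioo a b, u x t1) + ∫ s in Ioi (0:ℝ), ∫ x in Ioo a b, B1 x s with hU1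
      have hUb : ∀ t ∈ It' Tmax, t1 ≤ t → (∫ x in Ioo a b, u x t) ≤ U1 := by
        intro t ht htt
        have hd : ∀ s ∈ Icc t1 t, _ := fun s hs => (sol_U hab hsol (hIcc t ht hs)).1
        have hsub : Icc t1 t ⊆ Ioi 0 := fun s hs => ht1.1.trans_le hs.1
        have h1 := intervalIntegral.sub_le_integral_of_hasDeriv_right_of_le htt
          (fun s hs => (hd s hs).continuousAt.continuousWithinAt)
          (fun s hs => (hd s (Ioo_subset_Icc_self hs)).hasDerivWithinAt)
          (hβ.mono_set hsub) (fun s hs => by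
            have := hUV0 s (hIcc t ht (Ioo_subset_Icc_self hs))
            linarith)
        rw [intervalIntegral.integral_of_le htt] at h1
        have h2 := setIntegral_mono_set hβ (ae_of_all _ hβ0)
          (LE.le.eventuallyLE (Ioc_subset_Icc_self.trans hsub) : Ioc t1 t ≤ᵐ[volume] Ioi 0)
        simp only [hU1]
        linarith
      set M := fun s => (∫ x in Ioo a b, u x s) + ∫ x in Ioo a b, v x s with hM
      set A := U1 + (b - a) * M1 + (b - a) * M2 with hA
      refine key (It' Tmax) (A + |M t1| + |A|) Subset.rfl fun t ht htt => ?_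
      have h1 := aux_gronwall (C := A) htt (E := M) (fun s hs =>
        (sol_U hab hsol (hIcc t ht hs)).1.add (sol_V hab hsol (hIcc t ht hs)).1) (fun s hs => by
          have hs' := hIcc t ht hs
          have := hb1 s hs'; have := hb2 s hs'; have := hUb s hs' hs.1
          simp only [hA, hM]
          linarith)
      have h3 := hU0 t ht
      have h4 : M t = (∫ x in Ioo a b, u x t) + ∫ x in Ioo a b, v x t := rfl
      linarith
    · -- (H2)
      set E := fun s => (∫ x in Ioo a b, u x s) + (∫ x in Ioo a b, v x s)
        - ∫ x in Ioo a b, log (v x s) with hE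
      set A := (b - a) * M1 + (b - a) * M2 + (b - a)
        + ((b - a)^3 / 4 + (b - a) * (- log (c / (b - a)) - 1)) with hA
      refine key (It' Tmax) (2 * (A + |E t1| + |A|)) Subset.rfl fun t ht htt => ?_
      have h1 := aux_gronwall (C := A) htt (E := E) (fun s hs =>
        ((sol_U hab hsol (hIcc t ht hs)).1.add (sol_V hab hsol (hIcc t ht hs)).1).sub
          (sol_L hab hsol (hIcc t ht hs)).1) (fun s hs => by
          have hs' := hIcc t ht hs
          have := hb1 s hs'
          have := hb2 s hs'
          have := aux_static hab hc (w := fun x => v x s) (w' := fun x => pdx v x s)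
            (B := fun x => B2 x s)
            (fun x hx => (hsol.v_reg x hx s hs').1.hasDerivAt)
            (aux_slice (sol_vx hsol) hs') (fun x hx => hsol.v_pos x hx s hs')
            (fun x => hB2n x s) (sol_V hab hsol hs').2 (sol_L hab hsol hs').2 (hH s hs'.1)
          simp only [hA, hE]
          linarith)
      have c4 := aux_slice hsol.v_cont (aux_It'_sub ht)
      have h2 : (∫ x in Ioo a b, log (v x t)) ≤ ∫ x in Ioo a b, v x t / 2 := by
        refine setIntegral_mono_on
          (aux_int (c4.log (fun x hx => (hsol.v_pos x hx t ht).ne')))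
          (aux_int (c4.div_const 2)) measurableSet_Ioo fun x hx => ?_
        have hp := hsol.v_pos x (Ioo_subset_Icc_self hx) t ht
        have h5 := log_le_sub_one_of_pos (half_pos hp)
        rw [log_div hp.ne' two_ne_zero] at h5
        have h6 := log_le_sub_one_of_pos (zero_lt_two (α := ℝ))
        linarith
      rw [integral_div] at h2
      have h3 := hU0 t ht
      have h4 : E t = (∫ x in Ioo a b, u x t) + (∫ x in Ioo a b, v x t)
        - ∫ x in Ioo a b, log (v x t) := rfl
      linarith
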